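/- For every i with 1 ≤ i ≤ n+m and every f ∈ Λ̄[x]: φ^{(i)}_{n,m}(D_k(f)) = k^{p(i)}·x_i·∂(φ^{(i)}_{n,m}(f))/∂x_i − (1/2)·Σ_{j≠i} k^{1−p(j)}·((x_i + x_j)/(x_i − x_j))·(φ^{(i)}_{n,m}(f) − φ^{(j)}_{n,m}(f)), as an identity in the field F of rational functions. -/

import Mathlib

open Polynomial MvPolynomial

noncomputable section

/-- Λ̄ = ℂ[p₀,p₁,…] -/
abbrev Lam : Type := MvPolynomial ℕ ℂ
/-- Λ̄[x] -/
abbrev LamX : Type := Polynomial Lam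

/-- the derivation on coefficients: p_l ↦ l·x^l -/
def coeffDerT : Derivation ℂ Lam LamX :=
  MvPolynomial.mkDerivation ℂ (fun l => (l : LamX) * Polynomial.X ^ l)

/-- ∂ : the ℂ-derivation of Λ̄[x] with ∂x = x, ∂p_l = l x^l. -/
def pdT (f : LamX) : LamX :=
  Polynomial.X * Polynomial.derivative f
    + f.sum (fun i c => coeffDerT c * Polynomial.X ^ i)

/-- Δ(x^l) = x^l p₀ + 2x^{l−1}p₁ + ⋯ + 2x·p_{l−1} + p_l − 2l·x^l (l > 0), Δ(1) = 0. -/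
def DvalsT (l : ℕ) : LamX :=
  if l = 0 then 0 else
    Polynomial.X ^ l * Polynomial.C (MvPolynomial.X 0)
      + Polynomial.C (MvPolynomial.X l)
      + 2 * (∑ j ∈ Finset.Ioo 0 l, Polynomial.X ^ (l - j) * Polynomial.C (MvPolynomial.X j))
      - (2 * l : LamX) * Polynomial.X ^ l

/-- Δ : Λ̄-linear, Δ(x^l f) = Δ(x^l)·f. -/
def DelT (f : LamX) : LamX := f.sum (fun l c => Polynomial.C c * DvalsT l)

/-- Dunkl–Heckman operator at infinity, D_k = ∂ − (k/2)Δ. -/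
def DkT (k : ℂ) (f : LamX) : LamX := pdT f - (k / 2) • DelT f

/-- E : Λ̄[x] → Λ̄, x^l f ↦ p_l f. -/
def E (f : LamX) : Lam := f.sum (fun l c => c * MvPolynomial.X l)

/-- the trigonometric CMS integrals at infinity L^{(r)} = E ∘ D_k^r restricted to Λ̄. -/
def LrT (k : ℂ) (r : ℕ) (f : Lam) : Lam := E ((DkT k)^[r] (Polynomial.C f))

end

noncomputable section

variable (n m : ℕ)

/-- the polynomial ring ℂ[x₁,…,x_{n+m}] -/
abbrev PR (n m : ℕ) : Type := MvPolynomial (Fin (n + m)) ℂ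
/-- F = ℂ(x₁,…,x_{n+m}), the field of rational functions -/
abbrev F (n m : ℕ) : Type := FractionRing (PR n m)

/-- the embedding ℂ[x₁,…,x_{n+m}] → ℂ(x₁,…,x_{n+m}) -/
def emb (f : PR n m) : F n m := algebraMap _ _ f

/-- image of x_i in F -/
def xi (i : Fin (n + m)) : F n m := emb n m (MvPolynomial.X i)

/-- image of a constant c ∈ ℂ in F -/
def cc (c : ℂ) : F n m := emb n m (MvPolynomial.C c)

/-- the parity p(i): 0 for the first n indices, 1 for the last m (valued in ℤ,
so that k^{p(i)}, k^{1−p(j)}, k^{−p(i)} make sense as zpow in the field F). -/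
def pE (i : Fin (n + m)) : ℤ := if (i : ℕ) < n then 0 else 1

/-- numerator of a chosen fraction representation of z ∈ F -/
def num (z : F n m) : PR n m :=
  (IsLocalization.sec (nonZeroDivisors (PR n m)) z).1

/-- denominator of a chosen fraction representation of z ∈ F -/
def den (z : F n m) : PR n m :=
  ((IsLocalization.sec (nonZeroDivisors (PR n m)) z).2 : PR n m)

/-- the partial derivative ∂/∂x_i on the field of rational functions F,
extending `MvPolynomial.pderiv i` by the quotient rule.  (Since z = num z / den z
for any z, this is exactly the unique extension of ∂/∂x_i to F.) -/
def fder (i : Fin (n + m)) (z : F n m) : F n m :=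
  (emb n m (pderiv i (num n m z)) * emb n m (den n m z)
    - emb n m (num n m z) * emb n m (pderiv i (den n m z)))
  / (emb n m (den n m z)) ^ 2

end

noncomputable section
variable (n m : ℕ) (k : ℂ)

/-- the common value φ_{n,m}(p_l) = Σ_j k^{−p(j)} x_j^l -/
def psum (l : ℕ) : F n m :=
  ∑ j : Fin (n + m), (cc n m k) ^ (-(pE n m j)) * (xi n m j) ^ l

/-- φ_{n,m} : Λ̄ → F, the ℂ-algebra homomorphism p_l ↦ Σ_j k^{−p(j)} x_j^l -/
def phinm : Lam →+* F n m :=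
  MvPolynomial.eval₂Hom ((algebraMap (PR n m) (F n m)).comp MvPolynomial.C)
    (fun l => psum n m k l)

/-- φ^{(i)}_{n,m} : Λ̄[x] → F, with x ↦ x_i and p_l ↦ Σ_j k^{−p(j)} x_j^l -/
def phiI (i : Fin (n + m)) (f : LamX) : F n m :=
  Polynomial.eval₂ (phinm n m k) (xi n m i) f

end

section Operators

lemma DkT_add (k : ℂ) (f g : LamX) : DkT k (f + g) = DkT k f + DkT k g := by
  have hp : pdT (f + g) = pdT f + pdT g := by
    unfold pdT
    rw [Polynomial.sum_add_index f g _ (by simp) (by intros; simp [add_mul]),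
      Polynomial.derivative_add]
    ring
  have hD : DelT (f + g) = DelT f + DelT g :=
    Polynomial.sum_add_index f g _ (by simp) (by intros; simp [add_mul])
  unfold DkT
  rw [hp, hD, smul_add]
  ring

lemma pdT_monomial (l : ℕ) (c : Lam) :
    pdT (Polynomial.monomial l c)
      = (l : LamX) * Polynomial.C c * Polynomial.X ^ l
        + coeffDerT c * Polynomial.X ^ l := by
  unfold pdT
  rw [Polynomial.sum_monomial_index _ _ (by simp), Polynomial.derivative_monomial,
    ← Polynomial.C_mul_X_pow_eq_monomial]
  rcases l with _ | l
  · simp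
  · simp only [Nat.add_sub_cancel, map_mul, map_natCast]
    ring

lemma DelT_monomial (l : ℕ) (c : Lam) :
    DelT (Polynomial.monomial l c) = Polynomial.C c * DvalsT l :=
  Polynomial.sum_monomial_index _ _ (by simp)

end Operators

/-- The quotient `(x + y) (x ^ l - y ^ l) / (x - y)`, written as a polynomial. -/
lemma sub_mul_sum_Ioo_eq {R : Type*} [CommRing R] (x y : R) (l : ℕ) (hl : l ≠ 0) :
    (x - y) * (x ^ l + y ^ l + 2 * ∑ a ∈ Finset.Ioo 0 l, x ^ (l - a) * y ^ a)
      = (x + y) * (x ^ l - y ^ l) := by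
  obtain ⟨l, rfl⟩ := Nat.exists_eq_succ_of_ne_zero hl
  induction l with
  | zero =>
    rw [show Finset.Ioo 0 (Nat.succ 0) = ∅ from rfl, Finset.sum_empty]
    ring
  | succ l ih =>
    have hI : Finset.Ioo 0 (l + 1 + 1) = insert (l + 1) (Finset.Ioo 0 (l + 1)) := by
      ext a; simp only [Finset.mem_Ioo, Finset.mem_insert]; omega
    have hS : ∑ a ∈ Finset.Ioo 0 (l + 1), x ^ (l + 1 + 1 - a) * y ^ a
        = x * ∑ a ∈ Finset.Ioo 0 (l + 1), x ^ (l + 1 - a) * y ^ a := by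
      rw [Finset.mul_sum]
      refine Finset.sum_congr rfl fun a ha => ?_
      rw [Finset.mem_Ioo] at ha
      rw [show l + 1 + 1 - a = (l + 1 - a) + 1 by omega, pow_succ]
      ring
    have h := ih (by omega)
    simp only [Nat.succ_eq_add_one] at h ⊢
    rw [hI, Finset.sum_insert (by simp), hS, show l + 1 + 1 - (l + 1) = 1 by omega]
    linear_combination x * h

noncomputable section
variable (n m : ℕ) (k : ℂ)

lemma emb_injective : Function.Injective (emb n m) :=
  IsFractionRing.injective (PR n m) (F n m)

lemma fder_emb (i : Fin (n + m)) (g : PR n m) :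
    fder n m i (emb n m g) = emb n m (pderiv i g) := by
  have hden : den n m (emb n m g) ≠ 0 :=
    nonZeroDivisors.ne_zero (IsLocalization.sec (nonZeroDivisors (PR n m)) (emb n m g)).2.2
  have hden' : emb n m (den n m (emb n m g)) ≠ 0 := fun h =>
    hden (emb_injective n m (h.trans (map_zero (algebraMap (PR n m) (F n m))).symm))
  have hmul : g * den n m (emb n m g) = num n m (emb n m g) := by
    apply emb_injective n m
    have h := IsLocalization.sec_spec (nonZeroDivisors (PR n m)) (emb n m g)
    exact (map_mul (algebraMap (PR n m) (F n m)) _ _).trans h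
  unfold fder
  rw [div_eq_iff (pow_ne_zero 2 hden'), ← hmul]
  simp only [emb, Derivation.leibniz, smul_eq_mul, map_add, map_mul]
  ring

/-- The image of `p_l`, as a polynomial in the `x_j`. -/
def psumPoly (l : ℕ) : PR n m :=
  ∑ j : Fin (n + m), MvPolynomial.C (k ^ (-(pE n m j))) * MvPolynomial.X j ^ l

/-- The homomorphism `phinm` with values in the polynomial ring. -/
def phiPoly : Lam →ₐ[ℂ] PR n m := MvPolynomial.aeval (psumPoly n m k)

lemma cc_zpow (z : ℤ) : cc n m (k ^ z) = cc n m k ^ z :=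
  map_zpow₀ ((algebraMap (PR n m) (F n m)).comp MvPolynomial.C) k z

lemma emb_psumPoly (l : ℕ) : emb n m (psumPoly n m k l) = _root_.psum n m k l := by
  unfold _root_.psum psumPoly
  simp only [← cc_zpow]
  simp [emb, cc, xi]

lemma emb_phiPoly (c : Lam) : emb n m (phiPoly n m k c) = phinm n m k c := by
  have h : (algebraMap (PR n m) (F n m)).comp (phiPoly n m k).toRingHom = phinm n m k := by
    apply MvPolynomial.ringHom_ext
    · intro r
      simp [phiPoly, phinm, MvPolynomial.algebraMap_eq]
    · intro l
      simpa [phiPoly, phinm, emb] using emb_psumPoly n m k l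
  exact congrArg (fun φ : Lam →+* F n m => φ c) h

/-- The homomorphism `phiI` with values in the polynomial ring. -/
def phiIPoly (i : Fin (n + m)) : LamX →+* PR n m :=
  Polynomial.eval₂RingHom (phiPoly n m k).toRingHom (MvPolynomial.X i)

lemma emb_phiIPoly (i : Fin (n + m)) (f : LamX) :
    emb n m (phiIPoly n m k i f) = phiI n m k i f := by
  have h : (algebraMap (PR n m) (F n m)).comp (phiPoly n m k).toRingHom = phinm n m k :=
    RingHom.ext (emb_phiPoly n m k)
  unfold phiI xi
  rw [← h]
  exact Polynomial.hom_eval₂ _ _ _ _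

lemma phiIPoly_C (i : Fin (n + m)) (c : Lam) :
    phiIPoly n m k i (Polynomial.C c) = phiPoly n m k c := by
  simp [phiIPoly]

lemma phiIPoly_X (i : Fin (n + m)) :
    phiIPoly n m k i Polynomial.X = MvPolynomial.X i := by
  simp [phiIPoly]

lemma phiIPoly_smul (i : Fin (n + m)) (a : ℂ) (f : LamX) :
    phiIPoly n m k i (a • f) = a • phiIPoly n m k i f := by
  rw [Algebra.smul_def, map_mul, Algebra.smul_def, Polynomial.algebraMap_apply, phiIPoly_C,
    AlgHom.commutes]

variable {k}

lemma pderiv_psumPoly (i : Fin (n + m)) (l : ℕ) :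
    MvPolynomial.X i * pderiv i (psumPoly n m k l)
      = MvPolynomial.C (k ^ (-(pE n m i))) * ((l : PR n m) * MvPolynomial.X i ^ l) := by
  unfold psumPoly
  rw [map_sum, Finset.sum_eq_single i]
  · rcases l with _ | l
    · simp
    · simp only [Derivation.leibniz, Derivation.leibniz_pow, pderiv_X_self, pderiv_C, smul_eq_mul,
        nsmul_eq_mul, Nat.add_sub_cancel]
      ring
  · intro j _ hj
    simp [Derivation.leibniz, Derivation.leibniz_pow, pderiv_X_of_ne hj]
  · simp

lemma phiIPoly_coeffDerT (hk : k ≠ 0) (i : Fin (n + m)) (c : Lam) :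
    phiIPoly n m k i (coeffDerT c)
      = MvPolynomial.C (k ^ pE n m i) * (MvPolynomial.X i * pderiv i (phiPoly n m k c)) := by
  induction c using MvPolynomial.induction_on with
  | C a =>
    have h : coeffDerT (MvPolynomial.C a) = 0 := MvPolynomial.derivation_C _ _
    simp [h, phiPoly]
  | add p q hp hq =>
    simp only [map_add, hp, hq]
    ring
  | mul_X p l hp =>
    have hX : phiIPoly n m k i (coeffDerT (MvPolynomial.X l))
        = MvPolynomial.C (k ^ pE n m i)
          * (MvPolynomial.X i * pderiv i (phiPoly n m k (MvPolynomial.X l))) := by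
      have h : coeffDerT (MvPolynomial.X l) = (l : LamX) * Polynomial.X ^ l :=
        MvPolynomial.mkDerivation_X _ _ _
      rw [h, phiPoly, MvPolynomial.aeval_X, pderiv_psumPoly, ← mul_assoc, ← map_mul,
        ← zpow_add₀ hk]
      simp [phiIPoly_X]
    have hsmul (a : Lam) (g : LamX) : a • g = Polynomial.C a * g := Polynomial.smul_eq_C_mul a
    simp only [Derivation.leibniz, hsmul, map_add, map_mul, phiIPoly_C, hp, hX, smul_eq_mul]
    ring

variable (k) in
lemma phiIPoly_DvalsT (i : Fin (n + m)) (l : ℕ) (hl : l ≠ 0) :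
    phiIPoly n m k i (DvalsT l)
      = ∑ j, MvPolynomial.C (k ^ (-(pE n m j)))
          * (MvPolynomial.X i ^ l + MvPolynomial.X j ^ l
            + 2 * ∑ a ∈ Finset.Ioo 0 l, MvPolynomial.X i ^ (l - a) * MvPolynomial.X j ^ a)
        - 2 * (l : PR n m) * MvPolynomial.X i ^ l := by
  have hp (a : ℕ) : phiPoly n m k (MvPolynomial.X a) = psumPoly n m k a :=
    MvPolynomial.aeval_X _ _
  simp only [DvalsT, if_neg hl, map_sub, map_add, map_mul, map_sum, map_pow, phiIPoly_X,
    phiIPoly_C, hp, map_ofNat, map_natCast]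
  congr 1
  simp only [mul_add, Finset.sum_add_distrib, psumPoly, Finset.mul_sum, pow_zero, mul_one]
  congr 1
  · congr 1
    exact Finset.sum_congr rfl fun j _ => mul_comm _ _
  · rw [Finset.sum_comm]
    refine Finset.sum_congr rfl fun j _ => Finset.sum_congr rfl fun a _ => ?_
    ring

lemma xi_sub_ne_zero {i j : Fin (n + m)} (hij : i ≠ j) : xi n m i - xi n m j ≠ 0 :=
  sub_ne_zero.mpr fun h => hij (MvPolynomial.X_injective (emb_injective n m h))

lemma cc_ne_zero (hk : k ≠ 0) : cc n m k ≠ 0 := fun h =>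
  hk (MvPolynomial.C_injective _ _
    ((emb_injective n m (h.trans (map_zero (algebraMap (PR n m) (F n m))).symm)).trans
      (map_zero MvPolynomial.C).symm))

/-- The image of `Δ(x^l)`: the term `j = i` is the correction between `∂` and the deformed
partial derivative. -/
lemma phiI_DvalsT (hk : k ≠ 0) (i : Fin (n + m)) (l : ℕ) :
    cc n m k * phiI n m k i (DvalsT l)
      = ∑ j ∈ Finset.univ.erase i, cc n m k ^ (1 - pE n m j)
            * ((xi n m i + xi n m j) * (xi n m i - xi n m j)⁻¹)
            * (xi n m i ^ l - xi n m j ^ l)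
        + 2 * (1 - cc n m k ^ pE n m i) * l * xi n m i ^ l := by
  rcases eq_or_ne l 0 with rfl | hl
  · simp [DvalsT, phiI]
  have hc := cc_ne_zero n m hk
  have hj (j : Fin (n + m)) (hj : j ∈ Finset.univ.erase i) :
      cc n m k ^ (1 - pE n m j) * ((xi n m i + xi n m j) * (xi n m i - xi n m j)⁻¹)
          * (xi n m i ^ l - xi n m j ^ l)
        = cc n m k * (cc n m k ^ (-pE n m j) * (xi n m i ^ l + xi n m j ^ l
            + 2 * ∑ a ∈ Finset.Ioo 0 l, xi n m i ^ (l - a) * xi n m j ^ a)) := by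
    have hne := xi_sub_ne_zero n m (Finset.ne_of_mem_erase hj).symm
    have h := sub_mul_sum_Ioo_eq (xi n m i) (xi n m j) l hl
    rw [sub_eq_add_neg 1, zpow_add₀ hc, zpow_one]
    field_simp
    linear_combination -h
  have hii : ∑ a ∈ Finset.Ioo 0 l, xi n m i ^ (l - a) * xi n m i ^ a
      = ((l : F n m) - 1) * xi n m i ^ l := by
    rw [Finset.sum_congr rfl (g := fun _ => xi n m i ^ l)]
    · have h1 : 1 ≤ l := Nat.one_le_iff_ne_zero.mpr hl
      simp [Nat.cast_sub h1]
    · intro a ha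
      rw [← pow_add, Nat.sub_add_cancel (Finset.mem_Ioo.mp ha).2.le]
  have hpar : cc n m k * cc n m k ^ (-pE n m i) = 1 + cc n m k - cc n m k ^ pE n m i := by
    unfold pE
    split_ifs
    · simp
    · simp [hc]
  have hD : phiI n m k i (DvalsT l)
      = ∑ j, cc n m k ^ (-pE n m j) * (xi n m i ^ l + xi n m j ^ l
            + 2 * ∑ a ∈ Finset.Ioo 0 l, xi n m i ^ (l - a) * xi n m j ^ a)
        - 2 * l * xi n m i ^ l := by
    rw [← emb_phiIPoly, phiIPoly_DvalsT n m k i l hl]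
    have h2 : algebraMap (PR n m) (F n m) 2 = 2 := map_ofNat _ 2
    simp only [← cc_zpow]
    simp [emb, cc, xi, h2]
  rw [Finset.sum_congr rfl hj, ← Finset.mul_sum, hD,
    ← Finset.add_sum_erase _ _ (Finset.mem_univ i), hii]
  linear_combination (2 * l * xi n m i ^ l) * hpar

lemma fder_phiI_add (i : Fin (n + m)) (f g : LamX) :
    fder n m i (phiI n m k i (f + g))
      = fder n m i (phiI n m k i f) + fder n m i (phiI n m k i g) := by
  simp only [← emb_phiIPoly, fder_emb, map_add]
  exact map_add (algebraMap (PR n m) (F n m)) _ _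

lemma phiI_add (i : Fin (n + m)) (f g : LamX) :
    phiI n m k i (f + g) = phiI n m k i f + phiI n m k i g :=
  Polynomial.eval₂_add _ _

lemma phiI_monomial (j : Fin (n + m)) (l : ℕ) (c : Lam) :
    phiI n m k j (Polynomial.monomial l c) = phinm n m k c * xi n m j ^ l :=
  Polynomial.eval₂_monomial _ _

lemma phiI_DkT (i : Fin (n + m)) (f : LamX) :
    phiI n m k i (DkT k f)
      = phiI n m k i (pdT f) - 1 / 2 * (cc n m k * phiI n m k i (DelT f)) := by
  have h2 : cc n m (k / 2) = 1 / 2 * cc n m k := by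
    have h := map_div₀ ((algebraMap (PR n m) (F n m)).comp MvPolynomial.C) k 2
    rw [map_ofNat] at h
    exact h.trans (by simp only [cc, emb, RingHom.comp_apply]; ring)
  rw [← mul_assoc, ← h2]
  simp only [← emb_phiIPoly, DkT, map_sub, phiIPoly_smul, MvPolynomial.smul_eq_C_mul]
  simp [emb, cc]

lemma phiI_pdT_monomial (hk : k ≠ 0) (i : Fin (n + m)) (l : ℕ) (c : Lam) :
    phiI n m k i (pdT (Polynomial.monomial l c))
      = cc n m k ^ pE n m i * xi n m i
          * fder n m i (phiI n m k i (Polynomial.monomial l c))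
        + (1 - cc n m k ^ pE n m i) * l * phinm n m k c * xi n m i ^ l := by
  have h : phiIPoly n m k i (pdT (Polynomial.monomial l c))
      = MvPolynomial.C (k ^ pE n m i) * MvPolynomial.X i
          * pderiv i (phiIPoly n m k i (Polynomial.monomial l c))
        + (1 - MvPolynomial.C (k ^ pE n m i)) * (l : PR n m) * phiPoly n m k c * MvPolynomial.X i ^ l := by
    rw [pdT_monomial, ← Polynomial.C_mul_X_pow_eq_monomial]
    simp only [map_add, map_mul, map_pow, phiIPoly_C, phiIPoly_X, map_natCast,
      phiIPoly_coeffDerT n m hk, Derivation.leibniz, Derivation.leibniz_pow, pderiv_X_self,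
      smul_eq_mul, nsmul_eq_mul]
    rcases l with _ | l
    · simp
      ring
    · simp only [Nat.add_sub_cancel]
      ring
  rw [← emb_phiIPoly, ← emb_phiIPoly, h, fder_emb, ← emb_phiPoly, ← cc_zpow]
  simp [emb, cc, xi]

end

/-- for 1 ≤ i ≤ n+m and f ∈ Λ̄[x],
φ^{(i)}(D_k f) = k^{p(i)} x_i ∂(φ^{(i)} f)/∂x_i
  − (1/2) Σ_{j≠i} k^{1−p(j)} ((x_i+x_j)/(x_i−x_j)) (φ^{(i)} f − φ^{(j)} f),
as an identity in the field F of rational functions (trigonometric case). -/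
theorem phi_DunklHeckman_deformed (n m : ℕ) (k : ℂ) (hk : k ≠ 0)
    (i : Fin (n + m)) (f : LamX) :
    phiI n m k i (DkT k f) =
      (cc n m k) ^ (pE n m i) * xi n m i * fder n m i (phiI n m k i f)
        - (1 / 2) * ∑ j ∈ Finset.univ.erase i,
            (cc n m k) ^ (1 - pE n m j)
              * ((xi n m i + xi n m j) * (xi n m i - xi n m j)⁻¹)
              * (phiI n m k i f - phiI n m k j f) := by
  induction f using Polynomial.induction_on' with
  | add f g hf hg =>
    rw [fder_phiI_add]
    simp only [DkT_add, phiI_add, hf, hg, add_sub_add_comm, mul_add,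
      Finset.sum_add_distrib]
  | monomial l c =>
    have hC : phiI n m k i (Polynomial.C c * DvalsT l)
        = phinm n m k c * phiI n m k i (DvalsT l) := by
      simp [phiI, Polynomial.eval₂_mul]
    rw [phiI_DkT, DelT_monomial, hC, phiI_pdT_monomial n m hk]
    have hsum : ∑ j ∈ Finset.univ.erase i,
          cc n m k ^ (1 - pE n m j) * ((xi n m i + xi n m j) * (xi n m i - xi n m j)⁻¹)
            * (phiI n m k i (Polynomial.monomial l c) - phiI n m k j (Polynomial.monomial l c))
        = phinm n m k c * ∑ j ∈ Finset.univ.erase i,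
          cc n m k ^ (1 - pE n m j) * ((xi n m i + xi n m j) * (xi n m i - xi n m j)⁻¹)
            * (xi n m i ^ l - xi n m j ^ l) := by
      rw [Finset.mul_sum]
      refine Finset.sum_congr rfl fun j _ => ?_
      rw [phiI_monomial, phiI_monomial]
      ring
    rw [hsum]
    linear_combination (-(1 / 2) * phinm n m k c) * phiI_DvalsT n m hk i l
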